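/- arXiv:math/0211268 — 2 statements merged into one kernel-verified Lean document; each statement's English description precedes it below -/
import Mathlib

section
/- For all integers m, n ≥ 1, every admissible shape S of P_{m,n} has at most ((3+√13)/2)^m admissible subshapes; in particular it has fewer than 3.31^m admissible subshapes. -/
open Set

noncomputable section

/-- A point of the integer lattice `ℤ² ⊆ ℝ²`. -/
def IsLatticePoint (p : ℝ × ℝ) : Prop := ∃ a b : ℤ, p = ((a : ℝ), (b : ℝ))

/-- A triangle: the convex hull of three affinely independent points of `ℝ²`. -/
def IsTriangle (Δ : Set (ℝ × ℝ)) : Prop :=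
  ∃ p q r : ℝ × ℝ, AffineIndependent ℝ ![p, q, r] ∧ Δ = convexHull ℝ {p, q, r}

/-- `F` is a face of the triangle `Δ`: the empty set, a vertex, an edge,
or the whole triangle. -/
def IsFaceOf (F Δ : Set (ℝ × ℝ)) : Prop :=
  ∃ p q r : ℝ × ℝ, AffineIndependent ℝ ![p, q, r] ∧ Δ = convexHull ℝ {p, q, r} ∧
    (F = ∅ ∨ F = {p} ∨ F = {q} ∨ F = {r} ∨
     F = segment ℝ p q ∨ F = segment ℝ q r ∨ F = segment ℝ p r ∨ F = Δ)

/-- The determinant of the two edge vectors of the triangle `pqr` emanating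
from `p`; its absolute value is twice the Euclidean area of the triangle. -/
def triDet (p q r : ℝ × ℝ) : ℝ :=
  (q.1 - p.1) * (r.2 - p.2) - (q.2 - p.2) * (r.1 - p.1)

/-- A unimodular triangle: a lattice triangle of area `1/2`. -/
def IsUnimodularTriangle (Δ : Set (ℝ × ℝ)) : Prop :=
  ∃ p q r : ℝ × ℝ, IsLatticePoint p ∧ IsLatticePoint q ∧ IsLatticePoint r ∧
    AffineIndependent ℝ ![p, q, r] ∧ Δ = convexHull ℝ {p, q, r} ∧
    |triDet p q r| = 1

/-- `T` is a unimodular triangulation of the region `P`. -/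
def IsUnimodularTriangulation (P : Set (ℝ × ℝ)) (T : Set (Set (ℝ × ℝ))) : Prop :=
  T.Finite ∧ (∀ Δ ∈ T, IsUnimodularTriangle Δ ∧ Δ ⊆ P) ∧ ⋃₀ T = P ∧
  ∀ Δ₁ ∈ T, ∀ Δ₂ ∈ T, IsFaceOf (Δ₁ ∩ Δ₂) Δ₁ ∧ IsFaceOf (Δ₁ ∩ Δ₂) Δ₂

/-- The number of unimodular triangulations of the region `P`. -/
def numTriangulations (P : Set (ℝ × ℝ)) : ℕ :=
  Set.ncard {T | IsUnimodularTriangulation P T}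

/-- `f m n` is the number of unimodular triangulations of `[0,m] × [0,n]`. -/
def f (m n : ℕ) : ℕ :=
  numTriangulations (Set.Icc (0, 0) ((m : ℝ), (n : ℝ)))

/-- `Δ₂` lies above `Δ₁` (written `Δ₁ ≺ Δ₂`). -/
def LiesAbove (Δ₁ Δ₂ : Set (ℝ × ℝ)) : Prop :=
  ∃ x y₁ y₂ : ℝ, (x, y₁) ∈ Δ₁ \ Δ₂ ∧ (x, y₂) ∈ Δ₂ \ Δ₁ ∧ y₁ < y₂

/-- `Δ` is a `≺`-maximal triangle of the set of triangles `T`. -/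
def MaximalIn (Δ : Set (ℝ × ℝ)) (T : Set (Set (ℝ × ℝ))) : Prop :=
  Δ ∈ T ∧ ∀ Δ' ∈ T, ¬ LiesAbove Δ Δ'

/-- An admissible sequence `T 1, …, T (2mn)` for `P_{m,n}`: `T 1` is a unimodular
triangulation of `[0,m] × [0,n]` and each subsequent set arises by removing a
`≺`-maximal triangle. -/
def IsAdmissibleSeq (m n : ℕ) (T : ℕ → Set (Set (ℝ × ℝ))) : Prop :=
  IsUnimodularTriangulation (Set.Icc (0, 0) ((m : ℝ), (n : ℝ))) (T 1) ∧
  ∀ i, 2 ≤ i → i ≤ 2 * m * n →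
    ∃ Δ, MaximalIn Δ (T (i - 1)) ∧ T i = T (i - 1) \ {Δ}

/-- An admissible shape of `P_{m,n}`: the union of the triangles of some member
of an admissible sequence. -/
def IsAdmissibleShape (m n : ℕ) (S : Set (ℝ × ℝ)) : Prop :=
  ∃ (T : ℕ → Set (Set (ℝ × ℝ))) (i : ℕ),
    IsAdmissibleSeq m n T ∧ 1 ≤ i ∧ i ≤ 2 * m * n ∧ S = ⋃₀ (T i)

/-- `Tmax S`: the set of all unimodular triangles contained in `S` that are
`≺`-maximal in some unimodular triangulation of `S`. -/
def Tmax (S : Set (ℝ × ℝ)) : Set (Set (ℝ × ℝ)) :=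
  {Δ | IsUnimodularTriangle Δ ∧ Δ ⊆ S ∧
    ∃ T, IsUnimodularTriangulation S T ∧ MaximalIn Δ T}

/-- `F` is a valid set of removed triangles turning `S` into the subshape `S'`:
`F ⊆ Tmax S`, the triangles of `F` have pairwise disjoint interiors, their
interiors are disjoint from `S'`, and `S = S' ∪ ⋃F`. -/
def IsRemovedSet (S' S : Set (ℝ × ℝ)) (F : Set (Set (ℝ × ℝ))) : Prop :=
  F ⊆ Tmax S ∧
  (∀ Δ₁ ∈ F, ∀ Δ₂ ∈ F, Δ₁ ≠ Δ₂ → interior Δ₁ ∩ interior Δ₂ = ∅) ∧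
  (∀ Δ ∈ F, interior Δ ∩ S' = ∅) ∧
  S = S' ∪ ⋃₀ F

/-- `S'` is an admissible subshape of `S`. -/
def IsAdmissibleSubshape (m n : ℕ) (S' S : Set (ℝ × ℝ)) : Prop :=
  IsAdmissibleShape m n S' ∧ ∃ F, IsRemovedSet S' S F

/-- `#(S',S)`: the number of triangles removed from `S` to obtain the admissible
subshape `S'` (well defined by the uniqueness of the removed set). -/
def removedCount (S' S : Set (ℝ × ℝ)) : ℕ :=
  sInf {k | ∃ F, IsRemovedSet S' S F ∧ F.ncard = k}

/-! ### Counting families of disjoint intervals -/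

/-- The solution of `u (j + 2) = 3 * u (j + 1) + u j` with `u 0 = 1` and `u 1 = 3`. -/
def familyBound : ℕ → ℕ
  | 0 => 1
  | 1 => 3
  | j + 2 => 3 * familyBound (j + 1) + familyBound j

/-- Subfamilies of `X` whose intervals `[l x, r x]` do not overlap and end at `j` at the latest. -/
def disjointFamilies {α : Type*} (X : Set α) (l r : α → ℤ) (j : ℤ) : Set (Set α) :=
  {F | F ⊆ X ∧ F.Pairwise (fun x y => r x ≤ l y ∨ r y ≤ l x) ∧ ∀ x ∈ F, r x ≤ j}

lemma encard_image2_le {α β γ : Type*} (g : α → β → γ) (s : Set α) (t : Set β) :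
    (Set.image2 g s t).encard ≤ s.encard * t.encard := by
  rw [← Set.image_prod, ← Set.encard_prod]
  exact Set.encard_image_le _ _

lemma disjointFamilies_subset {α : Type*} {X A B : Set α} {l r : α → ℤ}
    (hX : X ⊆ A ∪ B) (hl : ∀ x ∈ X, l x < r x) (hB : ∀ x ∈ X, x ∈ B → l x + 2 ≤ r x) (j : ℤ) :
    disjointFamilies X l r j ⊆ disjointFamilies X l r (j - 1) ∪
      (Set.image2 insert {x | x ∈ X ∧ x ∈ A ∧ r x = j} (disjointFamilies X l r (j - 1)) ∪
       Set.image2 insert {x | x ∈ X ∧ x ∈ B ∧ r x = j} (disjointFamilies X l r (j - 2))) := by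
  rintro F ⟨hF, hp, hj⟩
  by_cases h : ∃ x ∈ F, r x = j
  · right
    obtain ⟨x, hx, hxj⟩ := h
    have key : ∀ k, l x ≤ k → F \ {x} ∈ disjointFamilies X l r k := by
      intro k hk
      refine ⟨fun y hy => hF hy.1, hp.mono Set.sdiff_subset, ?_⟩
      rintro y ⟨hy, hyx⟩
      have h1 := hp hy hx hyx
      have h2 := hj y hy
      have h3 := hl y (hF hy)
      omega
    have hins : insert x (F \ {x}) = F := by
      rw [Set.insert_sdiff_singleton, Set.insert_eq_of_mem hx]
    have h1 := hl x (hF hx)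
    rcases hX (hF hx) with hA | hb
    · left
      exact ⟨x, ⟨hF hx, hA, hxj⟩, F \ {x}, key _ (by omega), hins⟩
    · right
      have h2 := hB x (hF hx) hb
      exact ⟨x, ⟨hF hx, hb, hxj⟩, F \ {x}, key _ (by omega), hins⟩
  · left
    push Not at h
    refine ⟨hF, hp, fun x hx => ?_⟩
    have h1 := hj x hx
    have h2 := h x hx
    omega

lemma encard_disjointFamilies_le {α : Type*} {X A B : Set α} {l r : α → ℤ}
    (hX : X ⊆ A ∪ B) (h0 : ∀ x ∈ X, 0 ≤ l x) (hl : ∀ x ∈ X, l x < r x)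
    (hB : ∀ x ∈ X, x ∈ B → l x + 2 ≤ r x)
    (hA2 : ∀ j, {x | x ∈ X ∧ x ∈ A ∧ r x = j}.encard ≤ 2)
    (hB1 : ∀ j, {x | x ∈ X ∧ x ∈ B ∧ r x = j}.encard ≤ 1) (j : ℕ) :
    (disjointFamilies X l r j).encard ≤ familyBound j := by
  have step : ∀ j : ℤ, (disjointFamilies X l r j).encard ≤
      (disjointFamilies X l r (j - 1)).encard + (2 * (disjointFamilies X l r (j - 1)).encard +
        {x | x ∈ X ∧ x ∈ B ∧ r x = j}.encard * (disjointFamilies X l r (j - 2)).encard) := by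
    intro j
    refine (Set.encard_le_encard (disjointFamilies_subset hX hl hB j)).trans ?_
    refine (Set.encard_union_le _ _).trans ?_
    gcongr
    refine (Set.encard_union_le _ _).trans ?_
    gcongr
    · exact (encard_image2_le _ _ _).trans (by gcongr; exact hA2 j)
    · exact encard_image2_le _ _ _
  have hzero : (disjointFamilies X l r 0).encard ≤ 1 := by
    rw [← Set.encard_singleton (∅ : Set α)]
    refine Set.encard_le_encard ?_
    rintro F ⟨hF, -, hj⟩
    refine Set.eq_empty_of_forall_notMem fun x hx => ?_
    have h1 := h0 x (hF hx)
    have h2 := hl x (hF hx)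
    have h3 := hj x hx
    omega
  induction j using Nat.twoStepInduction with
  | zero => simpa [familyBound] using hzero
  | one =>
    have hemp : {x | x ∈ X ∧ x ∈ B ∧ r x = 1} = ∅ := by
      refine Set.eq_empty_of_forall_notMem ?_
      rintro x ⟨hx, hb, hr⟩
      have h1 := h0 x hx
      have h2 := hB x hx hb
      omega
    have h := step 1
    rw [hemp] at h
    simp only [sub_self, Set.encard_empty, zero_mul, add_zero] at h
    calc _ ≤ _ := h
      _ ≤ 1 + 2 * 1 := by gcongr
      _ = _ := by norm_num [familyBound]
  | more j ih1 ih2 =>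
    have h := step ((j + 2 : ℕ) : ℤ)
    rw [show ((j + 2 : ℕ) : ℤ) - 1 = ((j + 1 : ℕ) : ℤ) by push_cast; ring,
      show ((j + 2 : ℕ) : ℤ) - 2 = (j : ℤ) by push_cast; ring] at h
    calc _ ≤ _ := h
      _ ≤ (familyBound (j + 1) : ℕ∞) + (2 * familyBound (j + 1) + 1 * familyBound j) := by
        gcongr
        exact hB1 _
      _ = _ := by
        simp only [familyBound]
        push_cast
        ring

lemma familyBound_le_pow (j : ℕ) : (familyBound j : ℝ) ≤ ((3 + Real.sqrt 13) / 2) ^ j := by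
  have hs : Real.sqrt 13 ^ 2 = 13 := Real.sq_sqrt (by norm_num)
  have h3 : 3 ≤ Real.sqrt 13 := Real.le_sqrt_of_sq_le (by norm_num)
  induction j using Nat.twoStepInduction with
  | zero => simp [familyBound]
  | one => simp only [familyBound]; push_cast; linarith
  | more j ih1 ih2 =>
    simp only [familyBound]
    push_cast
    have : ((3 + Real.sqrt 13) / 2) ^ (j + 2) =
        3 * ((3 + Real.sqrt 13) / 2) ^ (j + 1) + ((3 + Real.sqrt 13) / 2) ^ j := by
      have hq : ((3 + Real.sqrt 13) / 2) ^ 2 = 3 * ((3 + Real.sqrt 13) / 2) + 1 := by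
        linear_combination hs / 4
      rw [pow_add, hq]
      ring
    linarith

/-! ### Triangles as intersections of half-planes -/

lemma mem_triangle_iff {p q r : ℝ × ℝ} (h : triDet p q r = 1) (z : ℝ × ℝ) :
    z ∈ convexHull ℝ {p, q, r} ↔ 0 ≤ triDet p q z ∧ 0 ≤ triDet q r z ∧ 0 ≤ triDet r p z := by
  constructor
  · have hc : ∀ p q : ℝ × ℝ, Convex ℝ {z | 0 ≤ triDet p q z} := by
      intro p q x hx y hy a b ha hb hab
      simp only [Set.mem_ofPred_eq, triDet, Prod.fst_add, Prod.snd_add, Prod.smul_fst,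
        Prod.smul_snd, smul_eq_mul] at *
      have := add_nonneg (mul_nonneg ha hx) (mul_nonneg hb hy)
      obtain rfl : b = 1 - a := by linarith
      linarith
    have hsub : convexHull ℝ {p, q, r} ⊆
        {z | 0 ≤ triDet p q z} ∩ ({z | 0 ≤ triDet q r z} ∩ {z | 0 ≤ triDet r p z}) := by
      refine convexHull_min ?_ ((hc p q).inter ((hc q r).inter (hc r p)))
      have h1 : triDet q r p = 1 := by rw [← h]; simp only [triDet]; ring
      have h2 : triDet r p q = 1 := by rw [← h]; simp only [triDet]; ring
      have h3 : ∀ x y : ℝ × ℝ, triDet x y x = 0 := by intro x y; simp only [triDet]; ring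
      have h4 : ∀ x y : ℝ × ℝ, triDet x y y = 0 := by intro x y; simp only [triDet]; ring
      rintro z (rfl | rfl | rfl) <;> simp [h, h1, h2, h3, h4]
    exact fun hz => hsub hz
  · rintro ⟨h1, h2, h3⟩
    have hsum : triDet q r z + triDet r p z + triDet p q z = 1 := by
      rw [← h]; simp only [triDet]; ring
    have hz : triDet q r z • p + triDet r p z • q + triDet p q z • r = z := by
      ext
      · simp only [triDet, Prod.fst_add, Prod.smul_fst, smul_eq_mul] at h ⊢
        linear_combination z.1 * h
      · simp only [triDet, Prod.snd_add, Prod.smul_snd, smul_eq_mul] at h ⊢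
        linear_combination z.2 * h
    have := (convex_convexHull ℝ ({p, q, r} : Set (ℝ × ℝ))).sum_mem (t := Finset.univ)
      (w := ![triDet q r z, triDet r p z, triDet p q z]) (z := ![p, q, r])
      (by intro i _; fin_cases i <;> simpa) (by simpa [Fin.sum_univ_three] using hsum)
      (by intro i _; apply subset_convexHull; fin_cases i <;> simp)
    simpa [Fin.sum_univ_three, hz] using this

lemma continuous_triDet (p q : ℝ × ℝ) : Continuous (triDet p q) := by
  unfold triDet; fun_prop

lemma mem_interior_triangle {p q r : ℝ × ℝ} (h : triDet p q r = 1) {z : ℝ × ℝ}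
    (h1 : 0 < triDet p q z) (h2 : 0 < triDet q r z) (h3 : 0 < triDet r p z) :
    z ∈ interior (convexHull ℝ {p, q, r}) := by
  rw [mem_interior]
  refine ⟨{z | 0 < triDet p q z} ∩ ({z | 0 < triDet q r z} ∩ {z | 0 < triDet r p z}),
    ?_, ?_, h1, h2, h3⟩
  · rintro z ⟨h1, h2, h3⟩
    exact (mem_triangle_iff h z).2 ⟨h1.le, h2.le, h3.le⟩
  · exact ((isOpen_Ioi.preimage (continuous_triDet p q))).inter
      ((isOpen_Ioi.preimage (continuous_triDet q r)).inter
        (isOpen_Ioi.preimage (continuous_triDet r p)))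

/-! ### Faces through interior points -/

lemma triDet_ne_zero {p q r : ℝ × ℝ} (h : AffineIndependent ℝ ![p, q, r]) :
    triDet p q r ≠ 0 := by
  intro h0
  rw [affineIndependent_iff_not_collinear_set] at h
  apply h
  by_cases hpq : q = p
  · subst hpq; simpa using collinear_pair ℝ q r
  have hn : (q.1 - p.1) ^ 2 + (q.2 - p.2) ^ 2 ≠ 0 := by
    intro hn
    apply hpq
    have h1 : q.1 - p.1 = 0 := by nlinarith [sq_nonneg (q.1 - p.1), sq_nonneg (q.2 - p.2)]
    have h2 : q.2 - p.2 = 0 := by nlinarith [sq_nonneg (q.1 - p.1), sq_nonneg (q.2 - p.2)]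
    ext <;> linarith
  rw [collinear_iff_of_mem (p₀ := p) (by simp)]
  refine ⟨q - p, ?_⟩
  rintro z (rfl | rfl | rfl)
  · exact ⟨0, by simp⟩
  · exact ⟨1, by simp⟩
  · refine ⟨((q.1 - p.1) * (z.1 - p.1) + (q.2 - p.2) * (z.2 - p.2)) /
      ((q.1 - p.1) ^ 2 + (q.2 - p.2) ^ 2), ?_⟩
    simp only [triDet] at h0
    ext
    · simp only [vadd_eq_add, Prod.fst_add, Prod.smul_fst, Prod.fst_sub, smul_eq_mul]
      field_simp
      linear_combination (-(q.2 - p.2)) * h0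
    · simp only [vadd_eq_add, Prod.snd_add, Prod.smul_snd, Prod.snd_sub, smul_eq_mul]
      field_simp
      linear_combination (q.1 - p.1) * h0

lemma triDet_ne_zero_of_mem_interior {p q r z : ℝ × ℝ} (h : triDet p q r ≠ 0)
    (hz : z ∈ interior (convexHull ℝ {p, q, r})) : triDet p q z ≠ 0 := by
  intro h0
  wlog hpos : 0 < triDet p q r generalizing p q
  · have hs : ∀ x, triDet q p x = - triDet p q x := by intro x; simp only [triDet]; ring
    refine this (p := q) (q := p) ?_ ?_ ?_ ?_
    · rw [hs]; exact neg_ne_zero.2 h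
    · rwa [Set.insert_comm]
    · rw [hs, h0, neg_zero]
    · rw [hs]
      have := lt_of_le_of_ne (not_lt.1 hpos) h
      linarith
  have hhalf : ∀ x ∈ convexHull ℝ {p, q, r}, 0 ≤ triDet p q x := by
    refine convexHull_min (t := {x | 0 ≤ triDet p q x}) ?_ ?_
    · rintro x (rfl | rfl | rfl)
      · simp [triDet]
      · simp only [triDet, Set.mem_ofPred_eq]; ring_nf; rfl
      · exact hpos.le
    · intro x hx y hy a b ha hb hab
      simp only [Set.mem_ofPred_eq, triDet, Prod.fst_add, Prod.snd_add, Prod.smul_fst,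
        Prod.smul_snd, smul_eq_mul] at *
      have := add_nonneg (mul_nonneg ha hx) (mul_nonneg hb hy)
      obtain rfl : b = 1 - a := by linarith
      linarith
  -- move slightly from `z` away from `r`
  have hcont : Continuous (fun s : ℝ => z + s • (z - r)) := by fun_prop
  have hev : ∀ᶠ s in nhds (0 : ℝ), z + s • (z - r) ∈ interior (convexHull ℝ {p, q, r}) := by
    refine hcont.continuousAt.eventually_mem ?_
    simpa using isOpen_interior.mem_nhds hz
  obtain ⟨ε, hε, hball⟩ := Metric.eventually_nhds_iff.1 hev
  have hmem := hhalf _ (interior_subset (hball (y := ε / 2)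
    (by rw [Real.dist_eq, sub_zero, abs_of_pos] <;> linarith)))
  have hval : triDet p q (z + (ε / 2) • (z - r)) =
      (1 + ε / 2) * triDet p q z - ε / 2 * triDet p q r := by
    simp only [triDet, Prod.fst_add, Prod.snd_add, Prod.smul_fst, Prod.smul_snd, Prod.fst_sub,
      Prod.snd_sub, smul_eq_mul]
    ring
  rw [hval, h0] at hmem
  nlinarith

lemma triDet_eq_zero_of_mem_segment {p q z : ℝ × ℝ} (hz : z ∈ segment ℝ p q) :
    triDet p q z = 0 := by
  obtain ⟨a, b, -, -, hab, rfl⟩ := hz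
  obtain rfl : a = 1 - b := by linarith
  simp only [triDet, Prod.fst_add, Prod.snd_add, Prod.smul_fst, Prod.smul_snd, smul_eq_mul]
  ring

lemma IsFaceOf.eq_of_mem_interior {F Δ : Set (ℝ × ℝ)} {z : ℝ × ℝ} (h : IsFaceOf F Δ)
    (hF : z ∈ F) (hz : z ∈ interior Δ) : F = Δ := by
  obtain ⟨p, q, r, hi, rfl, h⟩ := h
  have h0 := triDet_ne_zero hi
  have h1 : triDet q r p ≠ 0 := by
    intro h; apply h0; rw [← h]; simp only [triDet]; ring
  have h2 : triDet p r q ≠ 0 := by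
    intro h; apply h0; rw [← neg_eq_zero, ← h]; simp only [triDet]; ring
  have npq : z ∉ segment ℝ p q := fun hs =>
    triDet_ne_zero_of_mem_interior h0 hz (triDet_eq_zero_of_mem_segment hs)
  have nqr : z ∉ segment ℝ q r := fun hs =>
    triDet_ne_zero_of_mem_interior h1
      (by rwa [Set.pair_comm r p, Set.insert_comm q p]) (triDet_eq_zero_of_mem_segment hs)
  have npr : z ∉ segment ℝ p r := fun hs =>
    triDet_ne_zero_of_mem_interior h2
      (by rwa [Set.pair_comm r q]) (triDet_eq_zero_of_mem_segment hs)
  rcases h with rfl | rfl | rfl | rfl | rfl | rfl | rfl | rfl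
  · exact absurd hF (Set.notMem_empty z)
  · rw [Set.mem_singleton_iff] at hF; subst hF
    exact absurd (left_mem_segment ℝ _ _) npq
  · rw [Set.mem_singleton_iff] at hF; subst hF
    exact absurd (right_mem_segment ℝ _ _) npq
  · rw [Set.mem_singleton_iff] at hF; subst hF
    exact absurd (right_mem_segment ℝ _ _) nqr
  · exact absurd hF npq
  · exact absurd hF nqr
  · exact absurd hF npr
  · rfl

/-! ### Normal forms of unimodular triangles -/

/-- The inclusion `ℤ² ⊆ ℝ²`. -/
def toPlane (p : ℤ × ℤ) : ℝ × ℝ := (p.1, p.2)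

/-- `Δ` has vertices `a`, `v`, `c` from left to right, with `v` below the line `ac`. -/
def HangingTriangle (Δ : Set (ℝ × ℝ)) (a v c : ℤ × ℤ) : Prop :=
  a.1 ≤ v.1 ∧ v.1 ≤ c.1 ∧ a.1 < c.1 ∧
    (v.1 - a.1) * (c.2 - a.2) - (v.2 - a.2) * (c.1 - a.1) = 1 ∧
    Δ = convexHull ℝ {toPlane a, toPlane v, toPlane c}

/-- `Δ` has vertices `a`, `v`, `c` strictly from left to right, with `v` above the line `ac`. -/
def StandingTriangle (Δ : Set (ℝ × ℝ)) (a v c : ℤ × ℤ) : Prop :=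
  a.1 < v.1 ∧ v.1 < c.1 ∧
    (v.1 - a.1) * (c.2 - a.2) - (v.2 - a.2) * (c.1 - a.1) = -1 ∧
    Δ = convexHull ℝ {toPlane a, toPlane v, toPlane c}

lemma exists_normalForm_of_le {p q r : ℤ × ℤ} (hpq : p.1 ≤ q.1) (hqr : q.1 ≤ r.1)
    (h : |(q.1 - p.1) * (r.2 - p.2) - (q.2 - p.2) * (r.1 - p.1)| = 1) :
    ∃ a v c, HangingTriangle (convexHull ℝ {toPlane p, toPlane q, toPlane r}) a v c ∨
      StandingTriangle (convexHull ℝ {toPlane p, toPlane q, toPlane r}) a v c := by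
  have hpr : p.1 < r.1 := by
    refine lt_of_le_of_ne (hpq.trans hqr) fun he => ?_
    have h1 : q.1 - p.1 = 0 := by omega
    have h2 : r.1 - p.1 = 0 := by omega
    simp [h1, h2] at h
  rcases abs_eq (zero_le_one) |>.1 h with h | h
  · exact ⟨p, q, r, Or.inl ⟨hpq, hqr, hpr, h, rfl⟩⟩
  · rcases hpq.eq_or_lt with e | hpq'
    · exact ⟨q, p, r, Or.inl ⟨e.ge, hpr.le, by omega, by linear_combination -h,
        by rw [Set.insert_comm]⟩⟩
    rcases hqr.eq_or_lt with e | hqr'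
    · exact ⟨p, r, q, Or.inl ⟨hpr.le, e.ge, by omega, by linear_combination -h,
        by rw [Set.pair_comm]⟩⟩
    exact ⟨p, q, r, Or.inr ⟨hpq', hqr', h, rfl⟩⟩

lemma IsUnimodularTriangle.exists_normalForm {Δ : Set (ℝ × ℝ)} (h : IsUnimodularTriangle Δ) :
    ∃ a v c, HangingTriangle Δ a v c ∨ StandingTriangle Δ a v c := by
  obtain ⟨_, _, _, ⟨p1, p2, rfl⟩, ⟨q1, q2, rfl⟩, ⟨r1, r2, rfl⟩, -, rfl, h⟩ := h
  have key : ∀ p q r : ℤ × ℤ, |(q.1 - p.1) * (r.2 - p.2) - (q.2 - p.2) * (r.1 - p.1)| = 1 →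
      ∃ a v c, HangingTriangle (convexHull ℝ {toPlane p, toPlane q, toPlane r}) a v c ∨
        StandingTriangle (convexHull ℝ {toPlane p, toPlane q, toPlane r}) a v c := by
    intro p q r h
    wlog hpq : p.1 ≤ q.1 generalizing p q r
    · have := this q p r (by rw [← h, ← abs_neg]; congr 1; ring) (by omega)
      rwa [Set.insert_comm] at this
    by_cases hqr : q.1 ≤ r.1
    · exact exists_normalForm_of_le hpq hqr h
    by_cases hpr : p.1 ≤ r.1
    · have := exists_normalForm_of_le (p := p) (q := r) (r := q) hpr (by omega)
        (by rw [← h, ← abs_neg]; congr 1; ring)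
      rwa [Set.pair_comm] at this
    · have := exists_normalForm_of_le (p := r) (q := p) (r := q) (by omega) hpq
        (by rw [← h]; congr 1; ring)
      rwa [Set.insert_comm, Set.pair_comm] at this
  refine key (p1, p2) (q1, q2) (r1, r2) ?_
  simp only [triDet] at h
  exact_mod_cast h

/-! ### Tops of columns -/

/-- `(x, t)` is the highest point of `Δ` on a vertical line through the interior of `Δ`. -/
def IsColumnTop (Δ : Set (ℝ × ℝ)) (x t : ℝ) : Prop :=
  (x, t) ∈ Δ ∧ (∀ y, (x, y) ∈ Δ → y ≤ t) ∧
    ∃ δ > 0, ∀ ε, 0 < ε → ε < δ → (x, t - ε) ∈ interior Δ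

lemma HangingTriangle.exists_isColumnTop {Δ : Set (ℝ × ℝ)} {a v c : ℤ × ℤ}
    (h : HangingTriangle Δ a v c) {x : ℝ} (hax : (a.1 : ℝ) < x) (hxc : x < c.1) :
    ∃ t, IsColumnTop Δ x t ∧ ((c.1 : ℝ) - a.1) * (t - a.2) = ((c.2 : ℝ) - a.2) * (x - a.1) := by
  obtain ⟨h1, h2, h3, h4, rfl⟩ := h
  have hdet : triDet (toPlane a) (toPlane v) (toPlane c) = 1 := by
    simp only [triDet, toPlane]; exact_mod_cast h4
  rify at h1 h2 h3 h4
  have hw : (0 : ℝ) < (c.1 : ℝ) - a.1 := by linarith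
  obtain ⟨s, hs⟩ : ∃ s, s * ((c.1 : ℝ) - a.1) = x - a.1 :=
    ⟨(x - a.1) / ((c.1 : ℝ) - a.1), by field_simp⟩
  have hs0 : 0 < s := by by_contra hc; nlinarith
  have hs1 : s < 1 := by by_contra hc; nlinarith
  obtain rfl : x = a.1 + s * ((c.1 : ℝ) - a.1) := by linarith
  have d1 : ∀ y, triDet (toPlane a) (toPlane v)
      (a.1 + s * ((c.1 : ℝ) - a.1), a.2 + s * ((c.2 : ℝ) - a.2) - y) =
      s - y * (v.1 - a.1) := by
    intro y; simp only [triDet, toPlane]; linear_combination s * h4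
  have d2 : ∀ y, triDet (toPlane v) (toPlane c)
      (a.1 + s * ((c.1 : ℝ) - a.1), a.2 + s * ((c.2 : ℝ) - a.2) - y) =
      1 - s - y * (c.1 - v.1) := by
    intro y; simp only [triDet, toPlane]; linear_combination (1 - s) * h4
  have d3 : ∀ y, triDet (toPlane c) (toPlane a)
      (a.1 + s * ((c.1 : ℝ) - a.1), a.2 + s * ((c.2 : ℝ) - a.2) - y) = y * (c.1 - a.1) := by
    intro y; simp only [triDet, toPlane]; ring
  refine ⟨a.2 + s * ((c.2 : ℝ) - a.2), ⟨?_, ?_, ?_⟩, by ring⟩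
  · rw [mem_triangle_iff hdet]
    have e1 := d1 0
    have e2 := d2 0
    have e3 := d3 0
    simp only [sub_zero, zero_mul] at e1 e2 e3
    rw [e1, e2, e3]
    exact ⟨hs0.le, by linarith, le_rfl⟩
  · intro y hy
    rw [mem_triangle_iff hdet] at hy
    have e3 := d3 (a.2 + s * ((c.2 : ℝ) - a.2) - y)
    rw [sub_sub_cancel] at e3
    have := hy.2.2
    rw [e3] at this
    by_contra hcon
    nlinarith
  · refine ⟨min s (1 - s) / ((c.1 : ℝ) - a.1), by
      have : 0 < min s (1 - s) := lt_min hs0 (by linarith)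
      positivity, fun ε h0 hε => ?_⟩
    rw [lt_div_iff₀ hw, lt_min_iff] at hε
    refine mem_interior_triangle hdet ?_ ?_ ?_
    · rw [d1]; nlinarith
    · rw [d2]; nlinarith
    · rw [d3]; positivity

lemma StandingTriangle.exists_isColumnTop {Δ : Set (ℝ × ℝ)} {a v c : ℤ × ℤ}
    (h : StandingTriangle Δ a v c) {x : ℝ} (hax : (a.1 : ℝ) < x) (hxc : x < c.1) :
    ∃ t, IsColumnTop Δ x t ∧
      (x ≤ v.1 → ((v.1 : ℝ) - a.1) * (t - a.2) = ((v.2 : ℝ) - a.2) * (x - a.1)) ∧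
      (v.1 ≤ x → ((c.1 : ℝ) - v.1) * (t - v.2) = ((c.2 : ℝ) - v.2) * (x - v.1)) := by
  obtain ⟨h1, h2, h4, rfl⟩ := h
  have hdet : triDet (toPlane a) (toPlane c) (toPlane v) = 1 := by
    have : triDet (toPlane a) (toPlane v) (toPlane c) = -1 := by
      simp only [triDet, toPlane]; exact_mod_cast h4
    rw [← neg_neg (1 : ℝ), ← this]; simp only [triDet]; ring
  rify at h1 h2 h4
  rw [Set.pair_comm]
  have hw : (0 : ℝ) < (c.1 : ℝ) - a.1 := by linarith
  -- each of the two upper edges is handled by the values of the three determinants below its points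
  have key : ∀ t d k l : ℝ, 0 < d → 0 ≤ k → 0 ≤ l → k * l = 0 →
      (∀ y, triDet (toPlane a) (toPlane c) (x, t - y) = d - y * (c.1 - a.1)) →
      (∀ y, triDet (toPlane c) (toPlane v) (x, t - y) = k + y * (c.1 - v.1)) →
      (∀ y, triDet (toPlane v) (toPlane a) (x, t - y) = l + y * (v.1 - a.1)) →
      IsColumnTop (convexHull ℝ {toPlane a, toPlane c, toPlane v}) x t := by
    intro t d k l hd hk hl hkl d1 d2 d3
    refine ⟨?_, ?_, ?_⟩
    · rw [mem_triangle_iff hdet]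
      have e1 := d1 0
      have e2 := d2 0
      have e3 := d3 0
      simp only [sub_zero, zero_mul, add_zero] at e1 e2 e3
      rw [e1, e2, e3]
      exact ⟨hd.le, hk, hl⟩
    · intro y hy
      rw [mem_triangle_iff hdet] at hy
      have e2 := d2 (t - y)
      have e3 := d3 (t - y)
      rw [sub_sub_cancel] at e2 e3
      have hy2 := hy.2.1
      have hy3 := hy.2.2
      rw [e2] at hy2
      rw [e3] at hy3
      by_contra hcon
      rcases mul_eq_zero.1 hkl with rfl | rfl
      · nlinarith
      · nlinarith
    · refine ⟨d / ((c.1 : ℝ) - a.1), by positivity, fun ε h0 hε => ?_⟩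
      rw [lt_div_iff₀ hw] at hε
      refine mem_interior_triangle hdet ?_ ?_ ?_
      · rw [d1]; linarith
      · rw [d2]; nlinarith
      · rw [d3]; nlinarith
  have hwl : (0 : ℝ) < (v.1 : ℝ) - a.1 := by linarith
  have hwr : (0 : ℝ) < (c.1 : ℝ) - v.1 := by linarith
  rcases le_total x v.1 with hx | hx
  · obtain ⟨s, hs⟩ : ∃ s, s * ((v.1 : ℝ) - a.1) = x - a.1 :=
      ⟨(x - a.1) / ((v.1 : ℝ) - a.1), by field_simp⟩
    have hs0 : 0 < s := by by_contra hc; nlinarith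
    have hs1 : s ≤ 1 := by by_contra hc; nlinarith
    obtain rfl : x = a.1 + s * ((v.1 : ℝ) - a.1) := by linarith
    refine ⟨a.2 + s * ((v.2 : ℝ) - a.2), key _ s (1 - s) 0 hs0 (by linarith) le_rfl
      (by ring) ?_ ?_ ?_, fun _ => by ring, fun hx' => ?_⟩
    · intro y; simp only [triDet, toPlane]; linear_combination (-s) * h4
    · intro y; simp only [triDet, toPlane]; linear_combination (-(1 - s)) * h4
    · intro y; simp only [triDet, toPlane]; ring
    · have : (s - 1) * ((v.1 : ℝ) - a.1) = 0 := by linarith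
      obtain rfl : s = 1 := by
        rcases mul_eq_zero.1 this with h | h <;> linarith
      ring
  · obtain ⟨s, hs⟩ : ∃ s, s * ((c.1 : ℝ) - v.1) = x - v.1 :=
      ⟨(x - v.1) / ((c.1 : ℝ) - v.1), by field_simp⟩
    have hs0 : 0 ≤ s := by by_contra hc; nlinarith
    have hs1 : s < 1 := by by_contra hc; nlinarith
    obtain rfl : x = v.1 + s * ((c.1 : ℝ) - v.1) := by linarith
    refine ⟨v.2 + s * ((c.2 : ℝ) - v.2), key _ (1 - s) 0 s (by linarith) le_rfl hs0
      (by ring) ?_ ?_ ?_, fun hx' => ?_, fun _ => by ring⟩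
    · intro y; simp only [triDet, toPlane]; linear_combination (-(1 - s)) * h4
    · intro y; simp only [triDet, toPlane]; ring
    · intro y; simp only [triDet, toPlane]; linear_combination (-s) * h4
    · have : s * ((c.1 : ℝ) - v.1) = 0 := le_antisymm (by linarith) (by positivity)
      obtain rfl : s = 0 := by
        rcases mul_eq_zero.1 this with h | h <;> linarith
      ring

lemma IsColumnTop.isGreatest {S Δ : Set (ℝ × ℝ)} {x t : ℝ} (hΔ : Δ ∈ Tmax S) (ht : IsColumnTop Δ x t) :
    IsGreatest {y | (x, y) ∈ S} t := by
  obtain ⟨-, hS, T, ⟨-, -, hU, hf⟩, hT, hmax⟩ := hΔ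
  obtain ⟨htΔ, htop, δ, hδ, hin⟩ := ht
  refine ⟨hS htΔ, fun y hy => ?_⟩
  by_contra! hlt
  simp only [Set.mem_ofPred_eq] at hy
  rw [← hU] at hy
  obtain ⟨Δ', hT', hy⟩ := hy
  have hyΔ : (x, y) ∉ Δ := fun h => absurd (htop y h) (not_le.2 hlt)
  have hz := hin (δ / 2) (by linarith) (by linarith)
  have hz' : (x, t - δ / 2) ∈ Δ' := by
    by_contra hn
    exact hmax Δ' hT' ⟨x, _, y, ⟨interior_subset hz, hn⟩, ⟨hy, hyΔ⟩, by linarith⟩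
  obtain ⟨f1, f2⟩ := hf Δ hT Δ' hT'
  have e1 := f1.eq_of_mem_interior ⟨interior_subset hz, hz'⟩ hz
  have hsub : Δ ⊆ Δ' := Set.inter_eq_left.1 e1
  have e2 := f2.eq_of_mem_interior ⟨interior_subset hz, hz'⟩ (interior_mono hsub hz)
  exact hyΔ (e1 ▸ e2.symm ▸ hy)

/-! ### Edges of the roof -/

/-- `pq` is a primitive lattice segment along the upper boundary of `S`. -/
def RoofEdge (S : Set (ℝ × ℝ)) (p q : ℤ × ℤ) : Prop :=
  p.1 < q.1 ∧ IsCoprime (q.1 - p.1) (q.2 - p.2) ∧ ∀ x : ℝ, p.1 < x → x < q.1 →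
    ∃ t, IsGreatest {y | (x, y) ∈ S} t ∧
      ((q.1 : ℝ) - p.1) * (t - p.2) = ((q.2 : ℝ) - p.2) * (x - p.1)

lemma RoofEdge.unique {S : Set (ℝ × ℝ)} {p q p' q' : ℤ × ℤ} (h : RoofEdge S p q)
    (h' : RoofEdge S p' q') (hq : q.1 = q'.1) : p = p' ∧ q = q' := by
  obtain ⟨hlt, hc, ht⟩ := h
  obtain ⟨hlt', hc', ht'⟩ := h'
  obtain ⟨M, hM, hM', hMq⟩ : ∃ M : ℝ, p.1 ≤ M ∧ p'.1 ≤ M ∧ M < q.1 :=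
    ⟨max p.1 p'.1, le_max_left _ _, le_max_right _ _,
      max_lt (by exact_mod_cast hlt) (by exact_mod_cast hq ▸ hlt')⟩
  have hqr : (q.1 : ℝ) = q'.1 := by exact_mod_cast hq
  have agree : ∀ x : ℝ, M < x → x < q.1 → ∃ t : ℝ,
      ((q.1 : ℝ) - p.1) * (t - p.2) = ((q.2 : ℝ) - p.2) * (x - p.1) ∧
      ((q'.1 : ℝ) - p'.1) * (t - p'.2) = ((q'.2 : ℝ) - p'.2) * (x - p'.1) := by
    intro x h1 h2
    obtain ⟨t, g, e⟩ := ht x (by linarith) h2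
    obtain ⟨t', g', e'⟩ := ht' x (by linarith) (by linarith)
    obtain rfl := g.unique g'
    exact ⟨t, e, e'⟩
  obtain ⟨t₁, e₁, e₁'⟩ := agree ((2 * M + q.1) / 3) (by linarith) (by linarith)
  obtain ⟨t₂, e₂, e₂'⟩ := agree ((M + 2 * q.1) / 3) (by linarith) (by linarith)
  have hcross : (q.1 - p.1) * (q'.2 - p'.2) = (q'.1 - p'.1) * (q.2 - p.2) := by
    have : ((q.1 : ℝ) - p.1) * (q'.2 - p'.2) = (q'.1 - p'.1) * (q.2 - p.2) := by
      have hne : ((q.1 : ℝ) - M) / 3 ≠ 0 := by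
        have : 0 < (q.1 : ℝ) - M := by linarith
        positivity
      apply mul_right_cancel₀ hne
      linear_combination ((q'.1 : ℝ) - p'.1) * (e₂ - e₁) - ((q.1 : ℝ) - p.1) * (e₂' - e₁')
    exact_mod_cast this
  have hw : q.1 - p.1 = q'.1 - p'.1 := by
    apply Int.dvd_antisymm (by omega) (by omega)
    · exact hc.dvd_of_dvd_mul_right ⟨_, hcross.symm⟩
    · exact hc'.dvd_of_dvd_mul_right ⟨_, hcross⟩
  have hd : q.2 - p.2 = q'.2 - p'.2 := by
    rw [hw] at hcross
    exact (mul_left_cancel₀ (by omega) hcross).symm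
  have hp1 : p.1 = p'.1 := by omega
  have hp2 : p.2 = p'.2 := by
    have hwr : ((q.1 : ℝ) - p.1) = q'.1 - p'.1 := by exact_mod_cast hw
    have hdr : ((q.2 : ℝ) - p.2) = q'.2 - p'.2 := by exact_mod_cast hd
    have hpr : (p.1 : ℝ) = p'.1 := by exact_mod_cast hp1
    rw [← hwr, ← hdr, ← hpr] at e₁'
    have hne : ((q.1 : ℝ) - p.1) ≠ 0 := by linarith
    have := mul_left_cancel₀ hne (e₁.trans e₁'.symm)
    have : (p.2 : ℝ) = p'.2 := by linarith
    exact_mod_cast this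
  exact ⟨Prod.ext hp1 hp2, Prod.ext hq (by omega)⟩

lemma HangingTriangle.roofEdge {S Δ : Set (ℝ × ℝ)} {a v c : ℤ × ℤ}
    (h : HangingTriangle Δ a v c) (hΔ : Δ ∈ Tmax S) : RoofEdge S a c := by
  refine ⟨h.2.2.1, ⟨-(v.2 - a.2), v.1 - a.1, by linear_combination h.2.2.2.1⟩, fun x h1 h2 => ?_⟩
  obtain ⟨t, ht, e⟩ := h.exists_isColumnTop h1 h2
  exact ⟨t, ht.isGreatest hΔ, e⟩

lemma StandingTriangle.roofEdge_right {S Δ : Set (ℝ × ℝ)} {a v c : ℤ × ℤ}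
    (h : StandingTriangle Δ a v c) (hΔ : Δ ∈ Tmax S) : RoofEdge S v c := by
  refine ⟨h.2.1, ⟨v.2 - a.2, -(v.1 - a.1), by linear_combination -h.2.2.1⟩, fun x h1 h2 => ?_⟩
  have h3 : (a.1 : ℝ) < v.1 := by exact_mod_cast h.1
  obtain ⟨t, ht, -, e⟩ := h.exists_isColumnTop (by linarith) h2
  exact ⟨t, ht.isGreatest hΔ, e h1.le⟩

lemma StandingTriangle.roofEdge_left {S Δ : Set (ℝ × ℝ)} {a v c : ℤ × ℤ}
    (h : StandingTriangle Δ a v c) (hΔ : Δ ∈ Tmax S) : RoofEdge S a v := by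
  refine ⟨h.1, ⟨-(c.2 - a.2), c.1 - a.1, by linear_combination -h.2.2.1⟩, fun x h1 h2 => ?_⟩
  have h3 : (v.1 : ℝ) < c.1 := by exact_mod_cast h.2.1
  obtain ⟨t, ht, e, -⟩ := h.exists_isColumnTop h1 (by linarith)
  exact ⟨t, ht.isGreatest hΔ, e h2.le⟩

lemma HangingTriangle.eq_of_iff {Δ Δ' : Set (ℝ × ℝ)} {a v v' c : ℤ × ℤ}
    (h : HangingTriangle Δ a v c) (h' : HangingTriangle Δ' a v' c)
    (hv : v.1 = c.1 ↔ v'.1 = c.1) : Δ = Δ' := by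
  obtain ⟨h1, h2, h3, h4, rfl⟩ := h
  obtain ⟨h1', h2', -, h4', rfl⟩ := h'
  have hcop : IsCoprime (c.1 - a.1) (c.2 - a.2) :=
    ⟨-(v.2 - a.2), v.1 - a.1, by linear_combination h4⟩
  have hdvd : c.1 - a.1 ∣ v.1 - v'.1 :=
    hcop.dvd_of_dvd_mul_right ⟨v.2 - v'.2, by linear_combination h4 - h4'⟩
  have hx : v.1 = v'.1 := by
    by_cases e : v.1 = c.1
    · rw [e, hv.1 e]
    · have e' : v'.1 ≠ c.1 := fun e' => e (hv.2 e')
      have := Int.eq_zero_of_abs_lt_dvd hdvd (by rw [abs_lt]; omega)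
      omega
  have hy : v.2 = v'.2 := by
    rw [hx] at h4
    have : (v.2 - v'.2) * (c.1 - a.1) = 0 := by linear_combination h4' - h4
    rcases mul_eq_zero.1 this with h | h <;> omega
  rw [Prod.ext hx hy]

/-! ### Removed sets determine subshapes -/

lemma IsColumnTop.interior_inter_nonempty {S Δ Δ' : Set (ℝ × ℝ)} {x t t' : ℝ} (hΔ : Δ ∈ Tmax S)
    (hΔ' : Δ' ∈ Tmax S) (ht : IsColumnTop Δ x t) (ht' : IsColumnTop Δ' x t') :
    (interior Δ ∩ interior Δ').Nonempty := by
  obtain rfl := (ht.isGreatest hΔ).unique (ht'.isGreatest hΔ')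
  obtain ⟨-, -, δ, hδ, hi⟩ := ht
  obtain ⟨-, -, δ', hδ', hi'⟩ := ht'
  have hm : 0 < min δ δ' := lt_min hδ hδ'
  have h1 := min_le_left δ δ'
  have h2 := min_le_right δ δ'
  exact ⟨(x, t - min δ δ' / 2), hi _ (by linarith) (by linarith),
    hi' _ (by linarith) (by linarith)⟩

lemma IsUnimodularTriangle.closure_interior {Δ : Set (ℝ × ℝ)} (h : IsUnimodularTriangle Δ) :
    closure (interior Δ) = Δ := by
  have hne : (interior Δ).Nonempty := by
    obtain ⟨a, v, c, h | h⟩ := h.exists_normalForm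
    · have h3 : (a.1 : ℝ) < c.1 := by exact_mod_cast h.2.2.1
      obtain ⟨t, ⟨-, -, δ, hδ, hi⟩, -⟩ :=
        h.exists_isColumnTop (x := ((a.1 : ℝ) + c.1) / 2) (by linarith) (by linarith)
      exact ⟨_, hi (δ / 2) (by linarith) (by linarith)⟩
    · have h3 : (a.1 : ℝ) < c.1 := by exact_mod_cast h.1.trans h.2.1
      obtain ⟨t, ⟨-, -, δ, hδ, hi⟩, -⟩ :=
        h.exists_isColumnTop (x := ((a.1 : ℝ) + c.1) / 2) (by linarith) (by linarith)
      exact ⟨_, hi (δ / 2) (by linarith) (by linarith)⟩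
  obtain ⟨p, q, r, -, -, -, -, rfl, -⟩ := h
  rw [(convex_convexHull ℝ _).closure_interior_eq_closure_of_nonempty_interior hne]
  exact ((Set.toFinite _).isCompact_convexHull ℝ).isClosed.closure_eq

lemma IsAdmissibleShape.exists_triangles {m n : ℕ} {S : Set (ℝ × ℝ)}
    (h : IsAdmissibleShape m n S) : ∃ T : Set (Set (ℝ × ℝ)), T.Finite ∧
      (∀ Δ ∈ T, IsUnimodularTriangle Δ ∧ Δ ⊆ Set.Icc (0, 0) ((m : ℝ), (n : ℝ))) ∧ S = ⋃₀ T := by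
  obtain ⟨T, i, ⟨⟨hfin, htri, -, -⟩, hstep⟩, h1, h2, rfl⟩ := h
  have hsub : T i ⊆ T 1 := by
    induction i, h1 using Nat.le_induction with
    | base => exact subset_rfl
    | succ k hk ih =>
      obtain ⟨Δ, -, e⟩ := hstep (k + 1) (by omega) h2
      rw [e, Nat.add_sub_cancel]
      exact Set.sdiff_subset.trans (ih (by omega))
  exact ⟨T i, hfin.subset hsub, fun Δ hΔ => htri Δ (hsub hΔ), rfl⟩

lemma IsRemovedSet.eq_closure {m n : ℕ} {S S' : Set (ℝ × ℝ)} {F : Set (Set (ℝ × ℝ))}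
    (hS' : IsAdmissibleShape m n S') (h : IsRemovedSet S' S F) : S' = closure (S \ ⋃₀ F) := by
  obtain ⟨T, hfin, htri, rfl⟩ := hS'.exists_triangles
  obtain ⟨hF, -, hdisj, hS⟩ := h
  apply Set.Subset.antisymm
  · rintro z ⟨Δ, hΔ, hz⟩
    rw [← (htri Δ hΔ).1.closure_interior] at hz
    refine closure_mono ?_ hz
    intro w hw
    refine ⟨by rw [hS]; exact Or.inl ⟨Δ, hΔ, interior_subset hw⟩, ?_⟩
    rintro ⟨Δ', hΔ', hw'⟩
    rw [← (hF hΔ').1.closure_interior, mem_closure_iff] at hw'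
    obtain ⟨u, hu, hu'⟩ := hw' _ isOpen_interior hw
    exact Set.notMem_empty u (hdisj Δ' hΔ' ▸ ⟨hu', Δ, hΔ, interior_subset hu⟩)
  · refine closure_minimal ?_ ?_
    · rintro z ⟨hz, hzF⟩
      rw [hS] at hz
      exact hz.resolve_right hzF
    · rw [Set.sUnion_eq_biUnion]
      refine hfin.isClosed_biUnion fun Δ hΔ => ?_
      rw [← (htri Δ hΔ).1.closure_interior]
      exact isClosed_closure

lemma encard_removable_families_le {m n : ℕ} {S : Set (ℝ × ℝ)} (hS : IsAdmissibleShape m n S) :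
    {F : Set (Set (ℝ × ℝ)) | F ⊆ Tmax S ∧ ∀ Δ₁ ∈ F, ∀ Δ₂ ∈ F, Δ₁ ≠ Δ₂ →
      interior Δ₁ ∩ interior Δ₂ = ∅}.encard ≤ familyBound m := by
  have hnf : ∀ Δ : Set (ℝ × ℝ), ∃ a v c, IsUnimodularTriangle Δ →
      HangingTriangle Δ a v c ∨ StandingTriangle Δ a v c := by
    intro Δ
    by_cases h : IsUnimodularTriangle Δ
    · obtain ⟨a, v, c, h⟩ := h.exists_normalForm
      exact ⟨a, v, c, fun _ => h⟩
    · exact ⟨0, 0, 0, fun h' => absurd h' h⟩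
  choose a v c hnf using hnf
  have hX : ∀ Δ ∈ Tmax S, HangingTriangle Δ (a Δ) (v Δ) (c Δ) ∨
      StandingTriangle Δ (a Δ) (v Δ) (c Δ) := fun Δ hΔ => hnf Δ hΔ.1
  have hlt : ∀ Δ ∈ Tmax S, (a Δ).1 < (c Δ).1 := by
    intro Δ hΔ
    rcases hX Δ hΔ with h | h
    · exact h.2.2.1
    · exact h.1.trans h.2.1
  have htop : ∀ Δ ∈ Tmax S, ∀ x : ℝ, (a Δ).1 < x → x < (c Δ).1 → ∃ t, IsColumnTop Δ x t := by
    intro Δ hΔ x h1 h2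
    rcases hX Δ hΔ with h | h
    · obtain ⟨t, ht, -⟩ := h.exists_isColumnTop h1 h2
      exact ⟨t, ht⟩
    · obtain ⟨t, ht, -⟩ := h.exists_isColumnTop h1 h2
      exact ⟨t, ht⟩
  have hbox : ∀ Δ ∈ Tmax S, 0 ≤ (a Δ).1 ∧ (c Δ).1 ≤ m := by
    intro Δ hΔ
    have hsub : Δ ⊆ Set.Icc (0, 0) ((m : ℝ), (n : ℝ)) := by
      obtain ⟨T, -, hT, rfl⟩ := hS.exists_triangles
      exact hΔ.2.1.trans (Set.sUnion_subset fun Δ' h => (hT Δ' h).2)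
    have heq : Δ = convexHull ℝ {toPlane (a Δ), toPlane (v Δ), toPlane (c Δ)} := by
      rcases hX Δ hΔ with h | h
      · exact h.2.2.2.2
      · exact h.2.2.2
    have ha : toPlane (a Δ) ∈ Δ :=
      (Set.ext_iff.1 heq _).2 (subset_convexHull _ _ (by simp))
    have hc : toPlane (c Δ) ∈ Δ :=
      (Set.ext_iff.1 heq _).2 (subset_convexHull _ _ (by simp))
    have h1 : (0 : ℝ) ≤ (a Δ).1 := (hsub ha).1.1
    have h2 : ((c Δ).1 : ℝ) ≤ m := (hsub hc).2.1
    exact ⟨by exact_mod_cast h1, by exact_mod_cast h2⟩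
  have main := encard_disjointFamilies_le (X := Tmax S)
    (A := {Δ | HangingTriangle Δ (a Δ) (v Δ) (c Δ)})
    (B := {Δ | StandingTriangle Δ (a Δ) (v Δ) (c Δ)})
    (l := fun Δ => (a Δ).1) (r := fun Δ => (c Δ).1) hX (fun Δ hΔ => (hbox Δ hΔ).1) hlt
    (fun Δ _ h => by have h1 := h.1; have h2 := h.2.1; omega) ?_ ?_ m
  · refine (Set.encard_le_encard ?_).trans main
    rintro F ⟨hF, hd⟩
    refine ⟨hF, ?_, fun Δ hΔ => (hbox Δ (hF hΔ)).2⟩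
    intro Δ hΔ Δ' hΔ' hne
    by_contra! hcon
    have h1 := hlt Δ (hF hΔ)
    have h2 := hlt Δ' (hF hΔ')
    obtain ⟨h3, h4⟩ := hcon
    rify at h1 h2 h3 h4
    obtain ⟨x, hx1, hx2⟩ := exists_between
      (show max ((a Δ).1 : ℝ) (a Δ').1 < min ((c Δ).1 : ℝ) (c Δ').1 by
        rw [max_lt_iff, lt_min_iff, lt_min_iff]; exact ⟨⟨h1, h4⟩, h3, h2⟩)
    rw [max_lt_iff] at hx1
    rw [lt_min_iff] at hx2
    obtain ⟨t, ht⟩ := htop Δ (hF hΔ) x hx1.1 hx2.1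
    obtain ⟨t', ht'⟩ := htop Δ' (hF hΔ') x hx1.2 hx2.2
    exact (ht.interior_inter_nonempty (hF hΔ) (hF hΔ') ht').ne_empty (hd Δ hΔ Δ' hΔ' hne)
  · intro j
    have hinj : Set.InjOn (fun Δ => (v Δ).1 = (c Δ).1)
        {Δ | Δ ∈ Tmax S ∧ Δ ∈ {Δ | HangingTriangle Δ (a Δ) (v Δ) (c Δ)} ∧ (c Δ).1 = j} := by
      rintro Δ ⟨hΔ, h, hj⟩ Δ' ⟨hΔ', h', hj'⟩ hv
      obtain ⟨ea, ec⟩ := (h.roofEdge hΔ).unique (h'.roofEdge hΔ') (hj.trans hj'.symm)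
      simp only [eq_iff_iff] at hv
      have h'' : HangingTriangle Δ' (a Δ) (v Δ') (c Δ) := by rw [ea, ec]; exact h'
      exact h.eq_of_iff h'' (by rw [hv, ec])
    rw [← hinj.encard_image]
    refine (Set.encard_le_encard (t := {True, False}) ?_).trans (Set.encard_pair true_ne_false).le
    intro P _
    simpa using Classical.propComplete P
  · intro j
    rw [Set.encard_le_one_iff]
    rintro Δ Δ' ⟨hΔ, h, hj⟩ ⟨hΔ', h', hj'⟩
    obtain ⟨ev, ec⟩ :=
      (h.roofEdge_right hΔ).unique (h'.roofEdge_right hΔ') (hj.trans hj'.symm)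
    obtain ⟨ea, -⟩ :=
      (h.roofEdge_left hΔ).unique (h'.roofEdge_left hΔ') (by rw [ev])
    rw [h.2.2.2, h'.2.2.2, ea, ev, ec]

/-- Every admissible shape of `P_{m,n}` has at most `((3+√13)/2)^m` admissible
subshapes; in particular it has fewer than `3.31^m` admissible subshapes. -/
theorem num_admissible_subshapes_le (m n : ℕ) (hm : 1 ≤ m) (hn : 1 ≤ n)
    (S : Set (ℝ × ℝ)) (hS : IsAdmissibleShape m n S) :
    {S' : Set (ℝ × ℝ) | IsAdmissibleSubshape m n S' S}.Finite ∧
    ({S' : Set (ℝ × ℝ) | IsAdmissibleSubshape m n S' S}.ncard : ℝ) ≤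
      ((3 + Real.sqrt 13) / 2) ^ m ∧
    ({S' : Set (ℝ × ℝ) | IsAdmissibleSubshape m n S' S}.ncard : ℝ) <
      (3.31 : ℝ) ^ m := by
  have hle : {S' : Set (ℝ × ℝ) | IsAdmissibleSubshape m n S' S}.encard ≤ familyBound m := by
    refine le_trans (Set.encard_le_encard ?_)
      ((Set.encard_image_le (fun F => closure (S \ ⋃₀ F)) _).trans (encard_removable_families_le hS))
    rintro S' ⟨hS', F, hF⟩
    exact ⟨F, ⟨hF.1, hF.2.1⟩, (hF.eq_closure hS').symm⟩
  have hfin := Set.finite_of_encard_le_coe hle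
  have hcard : ({S' : Set (ℝ × ℝ) | IsAdmissibleSubshape m n S' S}.ncard : ℝ) ≤
      ((3 + Real.sqrt 13) / 2) ^ m := by
    refine le_trans ?_ (familyBound_le_pow m)
    rw [← hfin.cast_ncard_eq] at hle
    exact_mod_cast hle
  refine ⟨hfin, hcard, hcard.trans_lt ?_⟩
  have hs : Real.sqrt 13 < 3.62 := by
    rw [Real.sqrt_lt' (by norm_num)]; norm_num
  exact pow_lt_pow_left₀ (by linarith) (by positivity) (by omega)
end
end

section
/- Let φ: ℕ → ℕ be defined by φ(0) = 1, φ(1) = 3, and φ(m) = 3·φ(m−1) + φ(m−2) for m ≥ 2. Then: (i) for every m ≥ 0, φ(m) equals the number of words of length m over the alphabet {0, α, β, γ} in which every occurrence of the letter γ is immediately preceded by the letter 0; and (ii) φ(m) < ((3+√13)/2)^m for every m ≥ 1. -/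
/-- A word over `{0, 1, 2, 3}` in which every `3` is immediately preceded by `0`. -/
def IsGoodWord {m : ℕ} (w : Fin m → Fin 4) : Prop :=
  ∀ i : Fin m, w i = 3 → ∃ j : Fin m, (j : ℕ) + 1 = (i : ℕ) ∧ w j = 0

theorem isGoodWord_snoc {m : ℕ} (w : Fin m → Fin 4) (a : Fin 4) :
    IsGoodWord (Fin.snoc w a : Fin (m + 1) → Fin 4) ↔
      IsGoodWord w ∧ (a = 3 → ∃ j : Fin m, (j : ℕ) + 1 = m ∧ w j = 0) := by
  unfold IsGoodWord
  rw [Fin.forall_fin_succ']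
  simp only [Fin.exists_fin_succ', Fin.snoc_castSucc, Fin.snoc_last, Fin.val_castSucc,
    Fin.val_last]
  refine and_congr (forall_congr' fun i => imp_congr_right fun _ => ?_)
    (imp_congr_right fun _ => ?_)
  · exact or_iff_left fun h => by have := i.isLt; omega
  · exact or_iff_left fun h => by omega

theorem isGoodWord_snoc_of_ne {m : ℕ} {w : Fin m → Fin 4} {a : Fin 4} (ha : a ≠ 3) :
    IsGoodWord (Fin.snoc w a : Fin (m + 1) → Fin 4) ↔ IsGoodWord w := by
  simp [isGoodWord_snoc, ha]

theorem isGoodWord_snoc_three {m : ℕ} (w : Fin (m + 1) → Fin 4) :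
    IsGoodWord (Fin.snoc w 3 : Fin (m + 2) → Fin 4) ↔
      IsGoodWord w ∧ w (Fin.last m) = 0 := by
  rw [isGoodWord_snoc]
  refine and_congr_right fun _ => ⟨fun h => ?_, fun h _ => ⟨Fin.last m, by simp, h⟩⟩
  obtain ⟨j, hj, hw⟩ := h rfl
  have : j = Fin.last m := by ext; simp only [Fin.val_last]; omega
  exact this ▸ hw

theorem isGoodWord_snoc_zero_three {m : ℕ} (w : Fin m → Fin 4) :
    IsGoodWord (Fin.snoc (Fin.snoc w 0 : Fin (m + 1) → Fin 4) 3 : Fin (m + 2) → Fin 4) ↔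
      IsGoodWord w := by
  rw [isGoodWord_snoc_three, isGoodWord_snoc_of_ne (by decide)]
  simp

/-- Extend a good word by a letter other than `3`, or by `0` followed by `3`. -/
def extendGoodWord (m : ℕ) :
    {w : Fin (m + 1) → Fin 4 // IsGoodWord w} × Fin 3 ⊕ {w : Fin m → Fin 4 // IsGoodWord w} →
      {w : Fin (m + 2) → Fin 4 // IsGoodWord w}
  | .inl (w, a) => ⟨Fin.snoc w.1 a.castSucc,
      (isGoodWord_snoc_of_ne (Fin.castSucc_ne_last a)).2 w.2⟩
  | .inr w => ⟨Fin.snoc (Fin.snoc w.1 0 : Fin (m + 1) → Fin 4) 3,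
      (isGoodWord_snoc_zero_three w.1).2 w.2⟩

theorem extendGoodWord_bijective (m : ℕ) : Function.Bijective (extendGoodWord m) := by
  constructor
  · rintro (⟨⟨w, hw⟩, a⟩ | ⟨w, hw⟩) (⟨⟨v, hv⟩, b⟩ | ⟨v, hv⟩) h <;>
      simp only [extendGoodWord, Subtype.mk.injEq, Fin.snoc_inj] at h
    · obtain ⟨rfl, h⟩ := h
      rw [Fin.castSucc_injective _ h]
    · exact absurd h.2 (Fin.castSucc_ne_last a)
    · exact absurd h.2.symm (Fin.castSucc_ne_last b)
    · obtain ⟨⟨rfl, -⟩, -⟩ := h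
      rfl
  · rintro ⟨w, hw⟩
    induction w using Fin.snocCases with
    | _ v a =>
    induction a using Fin.lastCases with
    | cast a =>
      exact ⟨.inl (⟨v, (isGoodWord_snoc_of_ne (Fin.castSucc_ne_last a)).1 hw⟩, a), rfl⟩
    | last =>
      induction v using Fin.snocCases with
      | _ u b =>
      obtain rfl : b = 0 := by simpa using ((isGoodWord_snoc_three _).1 hw).2
      exact ⟨.inr ⟨u, (isGoodWord_snoc_zero_three u).1 hw⟩, rfl⟩

theorem card_goodWord_add_two (m : ℕ) :
    Nat.card {w : Fin (m + 2) → Fin 4 // IsGoodWord w} =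
      3 * Nat.card {w : Fin (m + 1) → Fin 4 // IsGoodWord w} +
        Nat.card {w : Fin m → Fin 4 // IsGoodWord w} := by
  rw [← Nat.card_eq_of_bijective _ (extendGoodWord_bijective m), Nat.card_sum, Nat.card_prod,
    Nat.card_fin, mul_comm]

theorem card_goodWord_zero : Nat.card {w : Fin 0 → Fin 4 // IsGoodWord w} = 1 := by
  have : Unique {w : Fin 0 → Fin 4 // IsGoodWord w} :=
    ⟨⟨⟨Fin.elim0, fun i => i.elim0⟩⟩, fun _ => Subsingleton.elim _ _⟩
  exact Nat.card_unique

theorem card_goodWord_one : Nat.card {w : Fin 1 → Fin 4 // IsGoodWord w} = 3 := by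
  unfold IsGoodWord
  rw [Nat.card_eq_fintype_card]
  decide

/-- Let `φ` satisfy `φ 0 = 1`, `φ 1 = 3` and `φ (m+2) = 3 φ(m+1) + φ m`. Then
`φ m` is the number of words of length `m` over the alphabet `{0, α, β, γ}`
(encoded as `Fin 4`, with `0 = 0` and `γ = 3`) in which every occurrence of `γ`
is immediately preceded by `0`, and `φ m < ((3+√13)/2)^m` for all `m ≥ 1`. -/
theorem phi_counts_words_and_bound (φ : ℕ → ℕ)
    (h0 : φ 0 = 1) (h1 : φ 1 = 3)
    (hrec : ∀ m, φ (m + 2) = 3 * φ (m + 1) + φ m) :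
    (∀ m : ℕ, φ m = Nat.card {w : Fin m → Fin 4 //
        ∀ i : Fin m, w i = 3 → ∃ j : Fin m, (j : ℕ) + 1 = (i : ℕ) ∧ w j = 0}) ∧
    (∀ m : ℕ, 1 ≤ m → (φ m : ℝ) < ((3 + Real.sqrt 13) / 2) ^ m) := by
  constructor
  · change ∀ m : ℕ, φ m = Nat.card {w : Fin m → Fin 4 // IsGoodWord w}
    intro m
    induction m using Nat.twoStepInduction with
    | zero => rw [h0, card_goodWord_zero]
    | one => rw [h1, card_goodWord_one]
    | more m ih ih' => rw [hrec, card_goodWord_add_two, ih, ih']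
  · set r : ℝ := (3 + √13) / 2 with hr
    have hsq : r ^ 2 = 3 * r + 1 := by
      have : √13 ^ 2 = (13 : ℝ) := Real.sq_sqrt (by norm_num)
      rw [hr]
      linear_combination this / 4
    have hr3 : 3 < r := by
      have : (3 : ℝ) < √13 := Real.lt_sqrt_of_sq_lt (by norm_num)
      linarith
    have key : ∀ m : ℕ, (φ m : ℝ) ≤ r ^ m ∧ (φ (m + 1) : ℝ) < r ^ (m + 1) := by
      intro m
      induction m with
      | zero => simpa [h0, h1] using hr3
      | succ m ih =>
        refine ⟨ih.2.le, ?_⟩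
        have : r ^ (m + 1 + 1) = 3 * r ^ (m + 1) + r ^ m := by
          linear_combination r ^ m * hsq
        rw [this, hrec]
        push_cast
        linarith [ih.1, ih.2]
    intro m hm
    obtain ⟨k, rfl⟩ := Nat.exists_eq_add_of_le' hm
    exact (key k).2
end
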